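/- Let n ≥ 2, b ∈ {1, −1}, c ≥ 0 with c ≠ 2, and d be real with λ = c − d ≠ 0, and suppose the corresponding n×n tridiagonal matrix Q is invertible. Then the complex number coercion of trace(Q^{-2}) equals S / (κ_0² κ²), where S = 4ρ²n² − 8ρn(λ²−1) + 4ρ(1+λ²) + nc(φ_+⁴ r_+^{2n−2} − φ_-⁴ r_-^{2n−2})/κ_0 + 2(λ²−1)² + 16ρ²/κ_0² − 4ρc(φ_+² r_+^{2n−1} + φ_-² r_-^{2n−1})/κ_0² + 2(λ²−1)(φ_+² r_+^{2n−1} − φ_-² r_-^{2n−1})/κ_0. -/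

import Mathlib

/-- The sequence β₀ = 1, β₁ = d, βᵢ = c βᵢ₋₁ − βᵢ₋₂. -/
noncomputable def beta (c d : ℝ) : ℕ → ℝ
  | 0 => 1
  | 1 => d
  | i + 2 => c * beta c d (i + 1) - beta c d i

/-- The n×n symmetric tridiagonal matrix with diagonal (d, c, …, c, d) and
off-diagonal entries −b. -/
noncomputable def triQ (n : ℕ) (b c d : ℝ) : Matrix (Fin n) (Fin n) ℝ :=
  Matrix.of fun i j =>
    if i = j then (if (i : ℕ) = 0 ∨ (i : ℕ) = n - 1 then d else c)
    else if (i : ℕ) + 1 = (j : ℕ) ∨ (j : ℕ) + 1 = (i : ℕ) then -b else 0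

section GreenMatrix

theorem beta_add_two (c d : ℝ) (i : ℕ) :
    beta c d (i + 2) = c * beta c d (i + 1) - beta c d i := by
  rw [beta]

/-- The discrete Wronskian of `i ↦ β i` and its reflection depends only on the sum of indices. -/
theorem beta_wronskian (c d : ℝ) (i m : ℕ) :
    beta c d (i + 1) * beta c d (m + 1) - beta c d i * beta c d m
      = d * beta c d (i + m + 1) - beta c d (i + m) := by
  induction i generalizing m with
  | zero => simp [beta]
  | succ i ih =>
    have h := ih (m + 1)
    have e : i + 1 + m = i + (m + 1) := by omega
    rw [e, ← h, beta_add_two, beta_add_two]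
    ring

theorem triQ_row_sum {n : ℕ} (b c d : ℝ) (f : ℕ → ℝ) (i : Fin n) :
    ∑ k : Fin n, triQ n b c d i k * f k
      = (if (i : ℕ) = 0 ∨ (i : ℕ) = n - 1 then d else c) * f i
        - b * (if (i : ℕ) + 1 < n then f (i + 1) else 0)
        - b * (if 0 < (i : ℕ) then f (i - 1) else 0) := by
  have h : ∀ k : Fin n, triQ n b c d i k * f k
      = (if (i : ℕ) = (k : ℕ) then
          (if (i : ℕ) = 0 ∨ (i : ℕ) = n - 1 then d else c) * f k else 0)
        - b * (if (i : ℕ) + 1 = (k : ℕ) then f k else 0)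
        - b * (if 0 < (i : ℕ) then (if (i : ℕ) - 1 = (k : ℕ) then f k else 0) else 0) := by
    intro k
    simp only [triQ, Matrix.of_apply, Fin.ext_iff]
    split_ifs <;> first | omega | ring
  simp_rw [h]
  rw [Finset.sum_sub_distrib, Finset.sum_sub_distrib, ← Finset.mul_sum, ← Finset.mul_sum]
  rw [Fin.sum_univ_eq_sum_range (fun k => if (i : ℕ) = k then
      (if (i : ℕ) = 0 ∨ (i : ℕ) = n - 1 then d else c) * f k else 0) n,
    Fin.sum_univ_eq_sum_range (fun k => if (i : ℕ) + 1 = k then f k else 0) n,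
    Fin.sum_univ_eq_sum_range
      (fun k => if 0 < (i : ℕ) then (if (i : ℕ) - 1 = k then f k else 0) else 0) n]
  have hi := i.2
  have hi' : (i : ℕ) - 1 < n := by omega
  split_ifs <;> simp_all
  omega

/-- `(d β_{n-1} - β_{n-2})` times the inverse of `triQ n b c d`. -/
noncomputable def greenMatrix (n : ℕ) (b c d : ℝ) : Matrix (Fin n) (Fin n) ℝ :=
  Matrix.of fun i j => b ^ ((i : ℕ) + (j : ℕ)) *
    (beta c d (min (i : ℕ) j) * beta c d (n - 1 - max (i : ℕ) j))

theorem triQ_mul_greenMatrix (N : ℕ) {b : ℝ} (c d : ℝ) (hb : b ^ 2 = 1) :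
    triQ (N + 2) b c d * greenMatrix (N + 2) b c d
      = (d * beta c d (N + 1) - beta c d N) • (1 : Matrix (Fin (N + 2)) (Fin (N + 2)) ℝ) := by
  have hs : ∀ (k : ℕ), b * b ^ (k + 1) = b ^ k := by
    intro k; rw [pow_succ]; linear_combination b ^ k * hb
  have hp : ∀ k : ℕ, b ^ (k + k) = 1 := by
    intro k; rw [← two_mul, pow_mul, hb, one_pow]
  ext i j
  rw [Matrix.mul_apply]
  have h := triQ_row_sum b c d (fun k => b ^ (k + (j : ℕ)) *
    (beta c d (min k j) * beta c d (N + 2 - 1 - max k j))) i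
  simp only [greenMatrix, Matrix.of_apply]
  rw [h, Matrix.smul_apply, Matrix.one_apply]
  simp only [Fin.ext_iff]
  obtain ⟨i, hi⟩ := i
  obtain ⟨j, hj⟩ := j
  simp only [smul_eq_mul]
  clear h
  have hbb : ∀ k : ℕ, b * b ^ k = b ^ (k + 1) := fun k => (pow_succ' b k).symm
  have hb2 : ∀ k : ℕ, b ^ (k + 1 + 1) = b ^ k := fun k => by rw [← hbb, hs]
  rcases lt_trichotomy i j with hij | rfl | hij
  · obtain ⟨t, ht⟩ : ∃ t, N + 1 - j = t := ⟨_, rfl⟩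
    rcases i with _ | i
    · have e1 : min 1 j = 1 := by omega
      simp [e1, hij.ne, show max 1 j = j by omega, beta, ← mul_assoc, hbb, add_comm 1 j, hb2]
      ring
    · have e1 : min (i + 1 + 1) j = i + 2 := by omega
      have e2 : min (i + 1) j = i + 1 := by omega
      have e3 : min i j = i := by omega
      have e4 : max (i + 1 + 1) j = j := by omega
      have e5 : max (i + 1) j = j := by omega
      have e6 : max i j = j := by omega
      have g1 : ¬ (i + 1 = 0 ∨ i + 1 = N + 2 - 1) := by omega
      have g2 : i + 1 + 1 < N + 2 := by omega
      simp only [g1, g2, if_true, if_false, Nat.add_sub_cancel, e1, e2, e3, e4, e5, e6,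
        Nat.succ_pos, hij.ne, beta_add_two, ← mul_assoc, hbb]
      rw [show i + 1 + 1 + j + 1 = i + j + 1 + 1 + 1 by ring,
        show i + 1 + j = i + j + 1 by ring, hb2]
      ring
  · have hmin : ∀ k : ℕ, min (k + 1) k = k := by intro k; omega
    have hmax : ∀ k : ℕ, max (k + 1) k = k + 1 := by intro k; omega
    have hmin' : ∀ k : ℕ, min k (k + 1) = k := by intro k; omega
    have hmax' : ∀ k : ℕ, max k (k + 1) = k + 1 := by intro k; omega
    rcases i with _ | i
    · simp [beta, ← mul_assoc, ← pow_two, hb]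
    · obtain ⟨t, rfl⟩ : ∃ t, N = i + t := ⟨N - i, by omega⟩
      rcases t with _ | t
      · simp [← mul_assoc, hbb, hp, beta,
          show i + (i + 1) + 1 = (i + 1) + (i + 1) by ring]
      · have g1 : ¬ (i + 1 = 0 ∨ i + 1 = i + (t + 1) + 2 - 1) := by omega
        have g2 : i + 1 + 1 < i + (t + 1) + 2 := by omega
        simp only [g1, g2, if_true, if_false, Nat.add_sub_cancel, hmin, hmax, hmin', hmax',
          min_self, max_self, Nat.succ_pos, ← mul_assoc, hbb, hp]
        rw [show i + 1 + 1 + (i + 1) + 1 = (i + 2) + (i + 2) by ring,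
          show i + (i + 1) + 1 = (i + 1) + (i + 1) by ring, hp, hp,
          show i + (t + 1) + 2 - 1 - (i + 1) = t + 1 by omega,
          show i + (t + 1) + 2 - 1 - (i + 1 + 1) = t by omega]
        have w' := beta_wronskian c d (i + 1) t
        rw [show i + 1 + t = i + (t + 1) by ring, beta_add_two] at w'
        linear_combination w'
  · rcases i with _ | i
    · omega
    · have e1 : min (i + 1 + 1) j = j := by omega
      have e2 : min (i + 1) j = j := by omega
      have e3 : min i j = j := by omega
      have e4 : max (i + 1 + 1) j = i + 2 := by omega
      have e5 : max (i + 1) j = i + 1 := by omega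
      have e6 : max i j = i := by omega
      obtain ⟨t, rfl⟩ : ∃ t, N = i + t := ⟨N - i, by omega⟩
      rcases t with _ | t
      · simp [e2, e3, e5, e6, hij.ne', ← mul_assoc, hbb, beta,
          show i + 1 + j = i + j + 1 by ring]
        ring
      · have g1 : ¬ (i + 1 = 0 ∨ i + 1 = i + (t + 1) + 2 - 1) := by omega
        have g2 : i + 1 + 1 < i + (t + 1) + 2 := by omega
        simp only [g1, g2, if_true, if_false, Nat.add_sub_cancel, e1, e2, e3, e4, e5, e6,
          Nat.succ_pos, hij.ne', ← mul_assoc, hbb]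
        rw [show i + 1 + 1 + j + 1 = i + j + 1 + 1 + 1 by ring,
          show i + 1 + j = i + j + 1 by ring, hb2,
          show i + (t + 1) + 2 - 1 - (i + 1) = t + 1 by omega,
          show i + (t + 1) + 2 - 1 - (i + 2) = t by omega,
          show i + (t + 1) + 2 - 1 - i = t + 2 by omega, beta_add_two]
        ring

theorem beta_boundary_ne_zero {N : ℕ} {b c d : ℝ} (hb : b ^ 2 = 1)
    (hQ : IsUnit (triQ (N + 2) b c d)) : d * beta c d (N + 1) - beta c d N ≠ 0 := by
  intro h0
  have h := triQ_mul_greenMatrix N c d hb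
  rw [h0, zero_smul, hQ.mul_right_eq_zero] at h
  have hl : greenMatrix (N + 2) b c d 0 (Fin.last (N + 1)) = 0 := by rw [h]; rfl
  have hb0 : b ≠ 0 := by rintro rfl; norm_num at hb
  simp [greenMatrix, beta, hb0] at hl

theorem trace_triQ_inv_sq {N : ℕ} {b c d : ℝ} (hb : b ^ 2 = 1)
    (hQ : IsUnit (triQ (N + 2) b c d)) :
    Matrix.trace ((triQ (N + 2) b c d)⁻¹ ^ 2)
      = (∑ i ∈ Finset.range (N + 2), ∑ j ∈ Finset.range (N + 2),
          beta c d (min i j) ^ 2 * beta c d (N + 1 - max i j) ^ 2)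
        / (d * beta c d (N + 1) - beta c d N) ^ 2 := by
  have hW := beta_boundary_ne_zero hb hQ
  set W := d * beta c d (N + 1) - beta c d N with hWdef
  have hinv : (triQ (N + 2) b c d)⁻¹ = W⁻¹ • greenMatrix (N + 2) b c d := by
    apply Matrix.inv_eq_right_inv
    rw [Matrix.mul_smul, triQ_mul_greenMatrix N c d hb, smul_smul, inv_mul_cancel₀ hW, one_smul]
  rw [hinv, smul_pow, Matrix.trace_smul, pow_two (greenMatrix _ _ _ _), Matrix.trace,
    div_eq_inv_mul, smul_eq_mul, inv_pow]
  congr 1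
  rw [← Fin.sum_univ_eq_sum_range]
  refine Finset.sum_congr rfl fun i _ => ?_
  rw [← Fin.sum_univ_eq_sum_range, Matrix.diag_apply, Matrix.mul_apply]
  refine Finset.sum_congr rfl fun j _ => ?_
  have hp : b ^ ((i : ℕ) + j) * b ^ ((i : ℕ) + j) = 1 := by
    rw [← mul_pow, ← pow_two, hb, one_pow]
  simp only [greenMatrix, Matrix.of_apply, min_comm (j : ℕ) i, max_comm (j : ℕ) i,
    add_comm (j : ℕ) i, show N + 2 - 1 = N + 1 from rfl]
  linear_combination (beta c d (min i j) ^ 2 * beta c d (N + 1 - max i j) ^ 2) * hp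

end GreenMatrix

section Sums

theorem sum_sum_min_max {R : Type*} [CommRing R] (g h : ℕ → R) (m : ℕ) :
    ∑ i ∈ Finset.range m, ∑ j ∈ Finset.range m, g (min i j) * h (max i j)
      = ∑ j ∈ Finset.range m, h j * (2 * ∑ i ∈ Finset.range (j + 1), g i - g j) := by
  induction m with
  | zero => simp
  | succ m ih =>
    rw [Finset.sum_range_succ, Finset.sum_range_succ (fun j => h j * _), ← ih]
    simp_rw [Finset.sum_range_succ _ m]
    rw [Finset.sum_add_distrib]
    have h1 : ∑ i ∈ Finset.range m, g (min i m) * h (max i m)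
        = (∑ i ∈ Finset.range m, g i) * h m := by
      rw [Finset.sum_mul]
      refine Finset.sum_congr rfl fun i hi => ?_
      rw [Finset.mem_range] at hi
      rw [min_eq_left hi.le, max_eq_right hi.le]
    have h2 : ∑ i ∈ Finset.range m, g (min m i) * h (max m i)
        = (∑ i ∈ Finset.range m, g i) * h m := by
      rw [← h1]
      simp_rw [min_comm m, max_comm m]
    rw [h1, h2, min_self, max_self]
    ring

variable {r s : ℂ}

theorem sub_mul_sum_sq_pow (hrs : r * s = 1) (m : ℕ) :
    (r - s) * ∑ j ∈ Finset.range m, r ^ (2 * j) = s * (r ^ (2 * m) - 1) := by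
  induction m with
  | zero => simp
  | succ m ih =>
    rw [Finset.sum_range_succ, mul_add, ih, mul_add 2 m 1, pow_add]
    linear_combination (-1 * r * r ^ (2 * m)) * hrs

theorem add_mul_sub_mul_sum_pow_four (hrs : r * s = 1) (m : ℕ) :
    (r + s) * (r - s) * ∑ j ∈ Finset.range m, r ^ (2 * j) * r ^ (2 * j)
      = s ^ 2 * (r ^ (2 * m) * r ^ (2 * m) - 1) := by
  induction m with
  | zero => simp
  | succ m ih =>
    rw [Finset.sum_range_succ, mul_add, ih, mul_add 2 m 1, pow_add]
    linear_combination (-r ^ 2 * (r ^ (2 * m)) ^ 2 * (r * s + 1)) * hrs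

theorem sub_sq_mul_sum_mul_sq_pow (hrs : r * s = 1) (m : ℕ) :
    (r - s) ^ 2 * ∑ j ∈ Finset.range m, (j : ℂ) * r ^ (2 * j)
      = m * r ^ (2 * m) * s * (r - s) - (r ^ (2 * m) - 1) := by
  induction m with
  | zero => simp
  | succ m ih =>
    rw [Finset.sum_range_succ, mul_add, ih, mul_add 2 m 1, pow_add]
    push_cast
    linear_combination (-r ^ (2 * m) * (m + 1) * (r * (r - s)) + r ^ (2 * m)) * hrs

theorem two_mul_sum_range_cast (m : ℕ) :
    2 * ∑ j ∈ Finset.range m, (j : ℂ) = m * (m - 1) := by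
  induction m with
  | zero => simp
  | succ m ih =>
    rw [Finset.sum_range_succ, mul_add, ih]
    push_cast
    ring

theorem two_mul_sum_sq_sub_sq (l : ℂ) (hrs : r * s = 1) (hk : r - s ≠ 0) (m : ℕ) :
    2 * ∑ i ∈ Finset.range (m + 1), ((r - l) * r ^ i - (s - l) * s ^ i) ^ 2
        - ((r - l) * r ^ m - (s - l) * s ^ m) ^ 2
      = (r + s) / (r - s) * ((r - l) ^ 2 * r ^ (2 * m) - (s - l) ^ 2 * s ^ (2 * m))
        + (2 * (l ^ 2 - 1) - 2 * ((r - l) * (s - l))) - 4 * ((r - l) * (s - l)) * m := by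
  have hp : ∀ i : ℕ, ((r - l) * r ^ i - (s - l) * s ^ i) ^ 2
      = (r - l) ^ 2 * r ^ (2 * i) + (s - l) ^ 2 * s ^ (2 * i) - 2 * ((r - l) * (s - l)) := by
    intro i
    have h : r ^ i * s ^ i = 1 := by rw [← mul_pow, hrs, one_pow]
    rw [mul_comm 2 i, pow_mul, pow_mul]
    linear_combination (-2 * (r - l) * (s - l)) * h
  have h1 := sub_mul_sum_sq_pow hrs (m + 1)
  have h2 := sub_mul_sum_sq_pow (r := s) (s := r) (by rw [mul_comm, hrs]) (m + 1)
  simp_rw [hp]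
  rw [Finset.sum_sub_distrib, Finset.sum_add_distrib, ← Finset.mul_sum, ← Finset.mul_sum]
  simp only [Finset.sum_const, Finset.card_range, nsmul_eq_mul]
  rw [mul_add 2 m 1, pow_add] at h1 h2
  set X := ∑ i ∈ Finset.range (m + 1), r ^ (2 * i)
  set Y := ∑ i ∈ Finset.range (m + 1), s ^ (2 * i)
  push_cast
  generalize r ^ (2 * m) = p at *
  generalize s ^ (2 * m) = q at *
  field_simp
  linear_combination (2 * (r - l) ^ 2) * h1 - (2 * (s - l) ^ 2) * h2
    + (2 * p * r * (r - l) ^ 2 - 2 * q * s * (s - l) ^ 2 - 2 * (r - s)) * hrs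

theorem sum_sum_sq_mul_sq (l : ℂ) (hrs : r * s = 1) (hk : r - s ≠ 0) (M : ℕ) :
    ∑ i ∈ Finset.range (M + 1), ∑ j ∈ Finset.range (M + 1),
        ((r - l) * r ^ min i j - (s - l) * s ^ min i j) ^ 2 *
          ((r - l) * r ^ (M - max i j) - (s - l) * s ^ (M - max i j)) ^ 2
      = 4 * ((r - l) * (s - l)) ^ 2 * (M + 1) ^ 2
        - 8 * ((r - l) * (s - l)) * (M + 1) * (l ^ 2 - 1)
        + 4 * ((r - l) * (s - l)) * (1 + l ^ 2)
        + (M + 1) * (r + s) * ((r - l) ^ 4 * r ^ (2 * M) - (s - l) ^ 4 * s ^ (2 * M)) / (r - s)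
        + 2 * (l ^ 2 - 1) ^ 2
        + 16 * ((r - l) * (s - l)) ^ 2 / (r - s) ^ 2
        - 4 * ((r - l) * (s - l)) * (r + s)
            * ((r - l) ^ 2 * r ^ (2 * M + 1) + (s - l) ^ 2 * s ^ (2 * M + 1)) / (r - s) ^ 2
        + 2 * (l ^ 2 - 1)
            * ((r - l) ^ 2 * r ^ (2 * M + 1) - (s - l) ^ 2 * s ^ (2 * M + 1)) / (r - s) := by
  have hsr : s * r = 1 := by rw [mul_comm, hrs]
  have hpow : ∀ j : ℕ, r ^ j * s ^ j = 1 := fun j => by rw [← mul_pow, hrs, one_pow]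
  rw [sum_sum_min_max (fun i => ((r - l) * r ^ i - (s - l) * s ^ i) ^ 2)
    (fun i => ((r - l) * r ^ (M - i) - (s - l) * s ^ (M - i)) ^ 2)]
  simp_rw [two_mul_sum_sq_sub_sq l hrs hk]
  have hterm : ∀ j ∈ Finset.range (M + 1),
      ((r - l) * r ^ (M - j) - (s - l) * s ^ (M - j)) ^ 2 *
        ((r + s) / (r - s) * ((r - l) ^ 2 * r ^ (2 * j) - (s - l) ^ 2 * s ^ (2 * j))
          + (2 * (l ^ 2 - 1) - 2 * ((r - l) * (s - l))) - 4 * ((r - l) * (s - l)) * j)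
      = (r + s) / (r - s) * ((r - l) ^ 4 * r ^ (2 * M) - (s - l) ^ 4 * s ^ (2 * M))
        - 2 * ((r - l) * (s - l)) * (2 * (l ^ 2 - 1) - 2 * ((r - l) * (s - l)))
        + 8 * ((r - l) * (s - l)) ^ 2 * j
        - (r + s) / (r - s) * (r - l) ^ 2 * (s - l) ^ 2 * r ^ (2 * M)
            * (s ^ (2 * j) * s ^ (2 * j))
        + (r + s) / (r - s) * (r - l) ^ 2 * (s - l) ^ 2 * s ^ (2 * M)
            * (r ^ (2 * j) * r ^ (2 * j))
        + (- (r + s) / (r - s) * 2 * ((r - l) * (s - l)) * (r - l) ^ 2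
            + (2 * (l ^ 2 - 1) - 2 * ((r - l) * (s - l))) * (s - l) ^ 2 * s ^ (2 * M))
            * r ^ (2 * j)
        + ((r + s) / (r - s) * 2 * ((r - l) * (s - l)) * (s - l) ^ 2
            + (2 * (l ^ 2 - 1) - 2 * ((r - l) * (s - l))) * (r - l) ^ 2 * r ^ (2 * M))
            * s ^ (2 * j)
        - 4 * ((r - l) * (s - l)) * (s - l) ^ 2 * s ^ (2 * M) * (j * r ^ (2 * j))
        - 4 * ((r - l) * (s - l)) * (r - l) ^ 2 * r ^ (2 * M) * (j * s ^ (2 * j)) := by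
    intro j hj
    obtain ⟨t, rfl⟩ : ∃ t, M = j + t := ⟨M - j, by rw [Finset.mem_range] at hj; omega⟩
    have ht := hpow t
    have hj' := hpow (2 * j)
    have e : ((r - l) * r ^ t - (s - l) * s ^ t) ^ 2
        = (r - l) ^ 2 * (r ^ (2 * (j + t)) * s ^ (2 * j))
          + (s - l) ^ 2 * (s ^ (2 * (j + t)) * r ^ (2 * j)) - 2 * ((r - l) * (s - l)) := by
      have e1 : r ^ (2 * (j + t)) = r ^ (2 * j) * (r ^ t) ^ 2 := by ring
      have e2 : s ^ (2 * (j + t)) = s ^ (2 * j) * (s ^ t) ^ 2 := by ring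
      rw [e1, e2]
      linear_combination (-2 * (r - l) * (s - l)) * ht
        - ((r - l) ^ 2 * (r ^ t) ^ 2 + (s - l) ^ 2 * (s ^ t) ^ 2) * hj'
    rw [Nat.add_sub_cancel_left, e]
    generalize r ^ (2 * (j + t)) = P
    generalize s ^ (2 * (j + t)) = Q
    generalize r ^ (2 * j) = p at *
    generalize s ^ (2 * j) = q at *
    linear_combination ((r + s) / (r - s) * ((r - l) ^ 4 * P - (s - l) ^ 4 * Q)) * hj'
  rw [Finset.sum_congr rfl hterm]
  simp only [Finset.sum_add_distrib, Finset.sum_sub_distrib, ← Finset.mul_sum, Finset.sum_const,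
    Finset.card_range, nsmul_eq_mul]
  have r2 := sub_mul_sum_sq_pow hrs (M + 1)
  have s2 := sub_mul_sum_sq_pow hsr (M + 1)
  have r4 := add_mul_sub_mul_sum_pow_four hrs (M + 1)
  have s4 := add_mul_sub_mul_sum_pow_four hsr (M + 1)
  have rj := sub_sq_mul_sum_mul_sq_pow hrs (M + 1)
  have sj := sub_sq_mul_sum_mul_sq_pow hsr (M + 1)
  have j1 := two_mul_sum_range_cast (M + 1)
  have hP := hpow (2 * M)
  rw [mul_add 2 M 1, pow_add] at r2 s2 r4 s4 rj sj
  rw [pow_succ r (2 * M), pow_succ s (2 * M)]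
  push_cast at *
  generalize (∑ i ∈ Finset.range (M + 1), r ^ (2 * i)) = R2 at *
  generalize (∑ i ∈ Finset.range (M + 1), s ^ (2 * i)) = S2 at *
  generalize (∑ i ∈ Finset.range (M + 1), r ^ (2 * i) * r ^ (2 * i)) = R4 at *
  generalize (∑ i ∈ Finset.range (M + 1), s ^ (2 * i) * s ^ (2 * i)) = S4 at *
  generalize (∑ i ∈ Finset.range (M + 1), (i : ℂ) * r ^ (2 * i)) = Rj at *
  generalize (∑ i ∈ Finset.range (M + 1), (i : ℂ) * s ^ (2 * i)) = Sj at *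
  generalize (∑ i ∈ Finset.range (M + 1), (i : ℂ)) = J at *
  generalize r ^ (2 * M) = P at *
  generalize s ^ (2 * M) = Q at *
  generalize (M : ℂ) = m at *
  have hr0 : r ≠ 0 := left_ne_zero_of_mul_eq_one hrs
  have hP0 : P ≠ 0 := left_ne_zero_of_mul_eq_one hP
  obtain rfl : s = r⁻¹ := eq_inv_of_mul_eq_one_right hrs
  obtain rfl : Q = P⁻¹ := eq_inv_of_mul_eq_one_right hP
  have hk' : r⁻¹ - r ≠ 0 := sub_ne_zero.2 (sub_ne_zero.1 hk).symm
  obtain rfl : R2 = _ := eq_div_of_mul_eq hk (by rw [mul_comm, r2])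
  obtain rfl : S2 = _ := eq_div_of_mul_eq hk' (by rw [mul_comm, s2])
  obtain rfl : Rj = _ := eq_div_of_mul_eq (pow_ne_zero 2 hk) (by rw [mul_comm, rj])
  obtain rfl : Sj = _ := eq_div_of_mul_eq (pow_ne_zero 2 hk') (by rw [mul_comm, sj])
  obtain rfl : J = _ := eq_div_of_mul_eq (two_ne_zero) (by rw [mul_comm, j1])
  have hS4 : ∀ a b : ℂ, (r + r⁻¹) / (r - r⁻¹) * a * b * P * S4
      = a * b * P / (r - r⁻¹)
        * (r ^ 2 * (P⁻¹ * r⁻¹ ^ (2 * 1) * (P⁻¹ * r⁻¹ ^ (2 * 1)) - 1) / (r⁻¹ - r)) := by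
    intro a b
    rw [← s4]
    generalize r⁻¹ = s at *
    field_simp
    ring
  have hR4 : ∀ a b : ℂ, (r + r⁻¹) / (r - r⁻¹) * a * b * P⁻¹ * R4
      = a * b * P⁻¹ / (r - r⁻¹)
        * (r⁻¹ ^ 2 * (P * r ^ (2 * 1) * (P * r ^ (2 * 1)) - 1) / (r - r⁻¹)) := by
    intro a b
    rw [← r4]
    generalize r⁻¹ = s at *
    generalize P⁻¹ = Q at *
    field_simp
  rw [hS4, hR4]
  have hq : r ^ 2 - 1 ≠ 0 := by
    intro h
    exact hk (by field_simp; simpa using h)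
  rw [show r⁻¹ - r = -(r - r⁻¹) by ring, show r - r⁻¹ = (r ^ 2 - 1) / r by field_simp]
  simp only [inv_pow]
  field_simp
  ring

end Sums


theorem ofReal_beta_mul_sub {c d : ℝ} {r s : ℂ} (hrs : r * s = 1) (hsum : r + s = c) (i : ℕ) :
    (beta c d i : ℂ) * (r - s) = (r - (c - d)) * r ^ i - (s - (c - d)) * s ^ i := by
  induction i using Nat.twoStepInduction with
  | zero => simp [beta]
  | one => simp only [beta]; linear_combination (s - r) * hsum
  | more i h1 h2 =>
    rw [beta_add_two]
    push_cast
    rw [sub_mul, mul_assoc, h1, h2, ← hsum]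
    linear_combination
      ((r - (r + s - d)) * r ^ i - (s - (r + s - d)) * s ^ i) * hrs

theorem ofReal_trace_triQ_inv_sq {N : ℕ} {b c d : ℝ} {r s l : ℂ} (hb : b ^ 2 = 1)
    (hQ : IsUnit (triQ (N + 2) b c d)) (hrs : r * s = 1) (hsum : r + s = c) (hk : r - s ≠ 0)
    (hl : l = c - d) :
    ((Matrix.trace ((triQ (N + 2) b c d)⁻¹ ^ 2) : ℝ) : ℂ)
      = (∑ i ∈ Finset.range (N + 2), ∑ j ∈ Finset.range (N + 2),
        ((r - l) * r ^ min i j - (s - l) * s ^ min i j) ^ 2 *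
          ((r - l) * r ^ (N + 1 - max i j) - (s - l) * s ^ (N + 1 - max i j)) ^ 2)
        / ((r - s) ^ 2 * ((r - l) ^ 2 * r ^ (N + 1) - (s - l) ^ 2 * s ^ (N + 1)) ^ 2) := by
  have hW := beta_boundary_ne_zero hb hQ
  have hu := ofReal_beta_mul_sub (d := d) hrs hsum
  rw [← hl] at hu
  have hkap : ((d * beta c d (N + 1) - beta c d N : ℝ) : ℂ) * (r - s)
      = (r - l) ^ 2 * r ^ (N + 1) - (s - l) ^ 2 * s ^ (N + 1) := by
    have hd : (d : ℂ) = r + s - l := by rw [hsum, hl]; ring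
    push_cast
    rw [sub_mul, mul_assoc, hu, hu, hd, pow_succ, pow_succ]
    linear_combination ((r - l) * r ^ N - (s - l) * s ^ N) * hrs
  rw [trace_triQ_inv_sq hb hQ, ← hkap]
  simp_rw [← hu]
  have hW' : ((d * beta c d (N + 1) - beta c d N : ℝ) : ℂ) ≠ 0 := by exact_mod_cast hW
  generalize d * beta c d (N + 1) - beta c d N = W at *
  have hsplit : ∀ i j : ℕ, ((beta c d (min i j) : ℂ) * (r - s)) ^ 2
        * ((beta c d (N + 1 - max i j) : ℂ) * (r - s)) ^ 2
      = ((beta c d (min i j) : ℂ) ^ 2 * (beta c d (N + 1 - max i j) : ℂ) ^ 2) * (r - s) ^ 4 := by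
    intro i j; ring
  simp_rw [hsplit, ← Finset.sum_mul]
  push_cast
  field_simp

/-- Theorem, trace of Q⁻², c ≠ 2: for invertible Q,
tr(Q⁻²) = S/(κ₀² κ²) as complex numbers, with S as in the paper. -/
theorem trace_inv_sq_c_ne_two (n : ℕ) (hn : 2 ≤ n) (b c d : ℝ) (hb : b = 1 ∨ b = -1)
    (hc0 : 0 ≤ c) (hc : c ≠ 2) (hlam : c - d ≠ 0)
    (hQ : IsUnit (triQ n b c d)) :
    let lam : ℂ := (c : ℂ) - (d : ℂ)
    let rp : ℂ := ((c : ℂ) + ((c : ℂ) ^ 2 - 4) ^ ((1 : ℂ) / 2)) / 2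
    let rm : ℂ := ((c : ℂ) - ((c : ℂ) ^ 2 - 4) ^ ((1 : ℂ) / 2)) / 2
    let vp : ℂ := rp - lam
    let vm : ℂ := rm - lam
    let k0 : ℂ := rp - rm
    let kap : ℂ := vp ^ 2 * rp ^ (n - 1) - vm ^ 2 * rm ^ (n - 1)
    let rho : ℂ := vp * vm
    let S : ℂ :=
      4 * rho ^ 2 * (n : ℂ) ^ 2 - 8 * rho * (n : ℂ) * (lam ^ 2 - 1)
        + 4 * rho * (1 + lam ^ 2)
        + (n : ℂ) * (c : ℂ) * (vp ^ 4 * rp ^ (2 * n - 2) - vm ^ 4 * rm ^ (2 * n - 2)) / k0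
        + 2 * (lam ^ 2 - 1) ^ 2
        + 16 * rho ^ 2 / k0 ^ 2
        - 4 * rho * (c : ℂ) * (vp ^ 2 * rp ^ (2 * n - 1) + vm ^ 2 * rm ^ (2 * n - 1)) / k0 ^ 2
        + 2 * (lam ^ 2 - 1) * (vp ^ 2 * rp ^ (2 * n - 1) - vm ^ 2 * rm ^ (2 * n - 1)) / k0
    ((Matrix.trace ((triQ n b c d)⁻¹ ^ 2) : ℝ) : ℂ) = S / (k0 ^ 2 * kap ^ 2) := by
  intro lam rp rm vp vm k0 kap rho S
  obtain ⟨N, rfl⟩ : ∃ N, n = N + 2 := ⟨n - 2, by omega⟩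
  have hb2 : b ^ 2 = 1 := by rcases hb with rfl | rfl <;> norm_num
  have hsq : (((c : ℂ) ^ 2 - 4) ^ ((1 : ℂ) / 2)) ^ 2 = (c : ℂ) ^ 2 - 4 := by
    rw [one_div]
    exact Complex.cpow_ofNat_inv_pow _ 2
  have hrs : rp * rm = 1 := by
    simp only [rp, rm]; linear_combination (-1 / 4 : ℂ) * hsq
  have hsum : rp + rm = c := by simp only [rp, rm]; ring
  clear_value rp rm
  have hk : rp - rm ≠ 0 := by
    intro h
    have h4 : (c : ℂ) ^ 2 - 4 = 0 := by
      linear_combination (rp - rm) * h - (rp + rm + c) * hsum + 4 * hrs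
    have h4' : (c - 2) * (c + 2) = 0 := by
      have : c ^ 2 - 4 = 0 := by exact_mod_cast h4
      linear_combination this
    rcases mul_eq_zero.1 h4' with h | h
    · exact hc (by linarith)
    · linarith
  rw [ofReal_trace_triQ_inv_sq (l := lam) hb2 hQ hrs hsum hk rfl,
    sum_sum_sq_mul_sq lam hrs hk (N + 1), hsum]
  refine congrArg (· / (k0 ^ 2 * kap ^ 2)) ?_
  simp only [S, rho, vp, vm, k0, show 2 * (N + 2) - 2 = 2 * (N + 1) by omega,
    show 2 * (N + 2) - 1 = 2 * (N + 1) + 1 by omega]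
  push_cast
  ring
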